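/- Let A ∈ ℍ^{m×n}, W₁ ∈ ℍ^{n×m} with k₁ = max{Ind(AW₁), Ind(W₁A)}, let B ∈ ℍ^{p×q}, W₂ ∈ ℍ^{q×p} with k₂ = max{Ind(BW₂), Ind(W₂B)}, and let D ∈ ℍ^{n×p}. If every column of D lies in the right column space R_r((W₁A)^{k₁}) and every row of D lies in the left row space R_l((BW₂)^{k₂}), then X = A_{d,W₁} D B_{d,W₂} satisfies W₁ A W₁ X W₂ B W₂ = D, and it is the unique solution X ∈ ℍ^{m×q} of W₁ A W₁ X W₂ B W₂ = D all of whose columns lie in R_r((AW₁)^{k₁}) and all of whose rows lie in R_l((W₂B)^{k₂}). -/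

import Mathlib

open Matrix
open scoped Classical

noncomputable section

local notation "ℍ" => Quaternion ℝ

/-- The product of the entries of `A` along the `σ`-cycle of `j`, taken in forward
order starting at `j`:  `a_{j, σj} · a_{σj, σ²j} ⋯ a_{σ^{l-1}j, j}`. -/
def cycProd {n : ℕ} (A : Matrix (Fin n) (Fin n) ℍ) (σ : Equiv.Perm (Fin n)) (j : Fin n) : ℍ :=
  ((List.range (Function.minimalPeriod (⇑σ) j)).map
    fun t => A ((σ ^ t) j) ((σ ^ (t + 1)) j)).prod

/-- The minimal elements (leaders) of the `σ`-cycles not containing `i`, in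
increasing order. -/
def othersList {n : ℕ} (σ : Equiv.Perm (Fin n)) (i : Fin n) : List (Fin n) :=
  (Finset.univ.filter fun j =>
    ¬ σ.SameCycle i j ∧ ∀ t, σ.SameCycle j t → j ≤ t).sort (· ≤ ·)

/-- The `i`-th row determinant of a square quaternion matrix: the cycle containing
`i` is written first, starting at `i`; the remaining cycles follow, each starting at
its minimal element, ordered by increasing minimal elements; the sign `(-1)^{n-r}`
is the sign of the permutation. -/
def rdet {n : ℕ} (A : Matrix (Fin n) (Fin n) ℍ) (i : Fin n) : ℍ :=
  ∑ σ : Equiv.Perm (Fin n), ((Equiv.Perm.sign σ : ℤ) •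
    (cycProd A σ i * ((othersList σ i).map (cycProd A σ)).prod))

/-- The `j`-th column determinant of a square quaternion matrix (mirror convention:
the cycle containing `j` is written last, ending at `j`; the remaining cycles
precede it, ordered by decreasing minimal elements). -/
def cdet {n : ℕ} (A : Matrix (Fin n) (Fin n) ℍ) (j : Fin n) : ℍ :=
  ∑ σ : Equiv.Perm (Fin n), ((Equiv.Perm.sign σ : ℤ) •
    ((((othersList σ j).reverse.map (cycProd A σ)).prod) * cycProd A σ j))

/-- The determinant of a (Hermitian) quaternion matrix: all cycles ordered by
increasing minimal elements, each starting at its minimal element.  For Hermitian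
matrices this is the common value of all row and column determinants. -/
def qdet {n : ℕ} (A : Matrix (Fin n) (Fin n) ℍ) : ℍ :=
  ∑ σ : Equiv.Perm (Fin n), ((Equiv.Perm.sign σ : ℤ) •
    (((Finset.univ.filter fun j => ∀ t, σ.SameCycle j t → j ≤ t).sort (· ≤ ·)).map
      (cycProd A σ)).prod)

/-- The principal submatrix of `A` with rows and columns indexed by `β`. -/
def pSub {n : ℕ} (A : Matrix (Fin n) (Fin n) ℍ) (β : Finset (Fin n)) :
    Matrix (Fin β.card) (Fin β.card) ℍ :=
  fun a b => A ((β.orderIsoOfFin rfl) a) ((β.orderIsoOfFin rfl) b)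

/-- `|A^β_β|`, the determinant of the principal submatrix indexed by `β`. -/
def minorDet {n : ℕ} (A : Matrix (Fin n) (Fin n) ℍ) (β : Finset (Fin n)) : ℍ :=
  qdet (pSub A β)

/-- `cdet_i ((A)^β_β)` for `i ∈ β`. -/
def minorCdet {n : ℕ} (A : Matrix (Fin n) (Fin n) ℍ) (β : Finset (Fin n)) (i : Fin n) : ℍ :=
  if h : i ∈ β then cdet (pSub A β) ((β.orderIsoOfFin rfl).symm ⟨i, h⟩) else 0

/-- `rdet_j ((A)^α_α)` for `j ∈ α`. -/
def minorRdet {n : ℕ} (A : Matrix (Fin n) (Fin n) ℍ) (α : Finset (Fin n)) (j : Fin n) : ℍ :=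
  if h : j ∈ α then rdet (pSub A α) ((α.orderIsoOfFin rfl).symm ⟨j, h⟩) else 0

/-- The rank of a quaternion matrix: the dimension of its (left) row space. -/
def qrank {m n : ℕ} (A : Matrix (Fin m) (Fin n) ℍ) : ℕ :=
  Module.finrank ℍ (Submodule.span ℍ (Set.range A))

/-- `Ind A`: the smallest `k` with `rank A^{k+1} = rank A^k`. -/
def qindex {n : ℕ} (A : Matrix (Fin n) (Fin n) ℍ) : ℕ :=
  sInf {k | qrank (A ^ (k + 1)) = qrank (A ^ k)}

/-- `X` is the Moore–Penrose inverse of `A`. -/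
def IsMP {m n : ℕ} (A : Matrix (Fin m) (Fin n) ℍ) (X : Matrix (Fin n) (Fin m) ℍ) : Prop :=
  A * X * A = A ∧ X * A * X = X ∧ (A * X)ᴴ = A * X ∧ (X * A)ᴴ = X * A

/-- `X` is the Drazin inverse of `A`. -/
def IsDrazin {n : ℕ} (A X : Matrix (Fin n) (Fin n) ℍ) : Prop :=
  X * A * X = X ∧ A * X = X * A ∧ A ^ (qindex A + 1) * X = A ^ qindex A

/-- `X` is the W-weighted Drazin inverse of `A` with respect to `W`. -/
def IsWDrazin {m n : ℕ} (A : Matrix (Fin m) (Fin n) ℍ) (W : Matrix (Fin n) (Fin m) ℍ)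
    (X : Matrix (Fin m) (Fin n) ℍ) : Prop :=
  (A * W) ^ (max (qindex (A * W)) (qindex (W * A)) + 1) * X * W
      = (A * W) ^ max (qindex (A * W)) (qindex (W * A)) ∧
  X * W * A * W * X = X ∧ A * W * X = X * W * A

/-- If every column of `M` lies in the right column space of `N`, then `N` divides `M` on the
left. -/
theorem exists_eq_mul_right_of_columns {R : Type*} [Semiring R] {l m n : ℕ}
    {M : Matrix (Fin l) (Fin n) R} {N : Matrix (Fin l) (Fin m) R}
    (h : ∀ j, ∃ y : Fin m → R, (fun i => M i j) = N.mulVec y) :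
    ∃ Y : Matrix (Fin m) (Fin n) R, M = N * Y := by
  choose y hy using h
  exact ⟨fun i j => y j i, Matrix.ext fun i j => congrFun (hy j) i⟩

/-- If every row of `M` lies in the left row space of `N`, then `N` divides `M` on the right. -/
theorem exists_eq_mul_left_of_rows {R : Type*} [Semiring R] {l m n : ℕ}
    {M : Matrix (Fin n) (Fin l) R} {N : Matrix (Fin m) (Fin l) R}
    (h : ∀ i, ∃ y : Fin m → R, (fun j => M i j) = Matrix.vecMul y N) :
    ∃ Y : Matrix (Fin n) (Fin m) R, M = Y * N := by
  choose y hy using h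
  exact ⟨fun i j => y i j, Matrix.ext fun i j => congrFun (hy i) j⟩

theorem span_rows_mul_le {l m n : ℕ} (Z : Matrix (Fin l) (Fin m) ℍ) (M : Matrix (Fin m) (Fin n) ℍ) :
    Submodule.span ℍ (Set.range (Z * M)) ≤ Submodule.span ℍ (Set.range M) := by
  rw [Submodule.span_le]
  rintro _ ⟨i, rfl⟩
  refine (Submodule.mem_span_range_iff_exists_fun ℍ).2 ⟨Z i, ?_⟩
  ext1 j
  simp [Matrix.mul_apply, Finset.sum_apply]

theorem qrank_mul_le {l m n : ℕ} (Z : Matrix (Fin l) (Fin m) ℍ) (M : Matrix (Fin m) (Fin n) ℍ) :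
    qrank (Z * M) ≤ qrank M :=
  Submodule.finrank_mono (span_rows_mul_le Z M)

/-- A matrix with the same rank as its left multiple `Z * M` is itself a left multiple of it. -/
theorem exists_eq_mul_of_qrank_eq {l m n : ℕ} {Z : Matrix (Fin l) (Fin m) ℍ}
    {M : Matrix (Fin m) (Fin n) ℍ} (h : qrank (Z * M) = qrank M) :
    ∃ Y : Matrix (Fin m) (Fin l) ℍ, M = Y * (Z * M) := by
  have hspan := Submodule.eq_of_le_of_finrank_eq (span_rows_mul_le Z M) h
  refine exists_eq_mul_left_of_rows fun i => ?_
  have hi : M i ∈ Submodule.span ℍ (Set.range (Z * M)) :=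
    hspan ▸ Submodule.subset_span ⟨i, rfl⟩
  obtain ⟨c, hc⟩ := (Submodule.mem_span_range_iff_exists_fun ℍ).1 hi
  refine ⟨c, ?_⟩
  ext1 j
  rw [← hc]
  simp only [Matrix.vecMul, dotProduct, Finset.sum_apply, Pi.smul_apply, smul_eq_mul]

/-- If some power `M ^ s` is a left multiple of `M ^ (s + 1)`, this already holds for every power
from the index of `M` on. -/
theorem exists_pow_eq_mul_pow_succ {n s k : ℕ} {M Y : Matrix (Fin n) (Fin n) ℍ}
    (hs : M ^ s = Y * M ^ (s + 1)) (hk : qindex M ≤ k) :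
    ∃ Z : Matrix (Fin n) (Fin n) ℍ, M ^ k = Z * M ^ (k + 1) := by
  have hmem : qindex M ∈ {k | qrank (M ^ (k + 1)) = qrank (M ^ k)} := by
    refine Nat.sInf_mem ⟨s, le_antisymm ?_ ?_⟩
    · rw [pow_succ']
      exact qrank_mul_le _ _
    · conv_lhs => rw [hs]
      exact qrank_mul_le _ _
  have hrank : qrank (M * M ^ qindex M) = qrank (M ^ qindex M) := by
    rw [← pow_succ']
    exact hmem
  obtain ⟨Z, hZ⟩ := exists_eq_mul_of_qrank_eq hrank
  obtain ⟨d, rfl⟩ := Nat.exists_eq_add_of_le hk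
  refine ⟨Z, ?_⟩
  rw [← pow_succ'] at hZ
  rw [add_right_comm, pow_add, pow_add, ← mul_assoc, ← hZ]

namespace IsWDrazin

variable {m n : ℕ} {A : Matrix (Fin m) (Fin n) ℍ} {W : Matrix (Fin n) (Fin m) ℍ}
  {X : Matrix (Fin m) (Fin n) ℍ}

theorem commute_left (h : IsWDrazin A W X) : Commute (A * W) (X * W) := by
  rw [commute_iff_eq, ← Matrix.mul_assoc, h.2.2]
  simp only [Matrix.mul_assoc]

theorem commute_right (h : IsWDrazin A W X) : Commute (W * A) (W * X) := by
  have := congrArg (W * ·) h.2.2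
  simpa only [commute_iff_eq, Matrix.mul_assoc] using this

theorem pow_mul_left (h : IsWDrazin A W X) :
    (A * W) ^ max (qindex (A * W)) (qindex (W * A)) * ((A * W) * (X * W)) =
      (A * W) ^ max (qindex (A * W)) (qindex (W * A)) := by
  have := h.1
  rwa [pow_succ, Matrix.mul_assoc, Matrix.mul_assoc] at this

theorem pow_mul_right (h : IsWDrazin A W X) :
    (W * A) ^ max (qindex (A * W)) (qindex (W * A)) * ((W * A) * (W * X)) =
      (W * A) ^ max (qindex (A * W)) (qindex (W * A)) := by
  have hswap (s : ℕ) : (W * A) ^ (s + 1) = W * (A * W) ^ s * A := by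
    induction s with
    | zero => simp
    | succ s ih => rw [pow_succ, ih, pow_succ]; simp only [Matrix.mul_assoc]
  have hle := le_max_right (qindex (A * W)) (qindex (W * A))
  have hpow := h.pow_mul_left
  generalize max (qindex (A * W)) (qindex (W * A)) = k at hle hpow ⊢
  have hsucc : (W * A) ^ (k + 1) * ((W * A) * (W * X)) = (W * A) ^ (k + 1) := by
    rw [h.commute_right.eq, hswap]
    conv_rhs => rw [← hpow, h.commute_left.eq]
    have e : A * (W * X * (W * A)) = X * W * (A * W) * A := by
      rw [← h.commute_left.eq]
      simp only [Matrix.mul_assoc]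
    simp only [Matrix.mul_assoc] at e ⊢
    rw [e]
  obtain ⟨Z, hZ⟩ := exists_pow_eq_mul_pow_succ (s := k + 1) (Y := W * X) (by
    conv_lhs => rw [← hsucc, ← mul_assoc, ← pow_succ]
    exact (h.commute_right.pow_left _).eq) hle
  rw [hZ, mul_assoc, hsucc]

theorem mul_pow_left (h : IsWDrazin A W X) (k : ℕ) : (A * W) ^ k * ((X * W) ^ k * X) = X := by
  have e : (A * W) * (X * W) * X = X := by
    rw [h.commute_left.eq]
    simpa only [Matrix.mul_assoc] using h.2.1
  rw [← Matrix.mul_assoc, ← h.commute_left.mul_pow]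
  induction k with
  | zero => simp
  | succ k ih => rw [pow_succ, Matrix.mul_assoc, e, ih]

theorem mul_pow_right (h : IsWDrazin A W X) (k : ℕ) : X * (W * X) ^ k * (W * A) ^ k = X := by
  have e : X * ((W * X) * (W * A)) = X := by
    rw [← h.commute_right.eq]
    simpa only [Matrix.mul_assoc] using h.2.1
  rw [Matrix.mul_assoc, ← h.commute_right.symm.mul_pow]
  induction k with
  | zero => simp
  | succ k ih => rw [pow_succ', ← Matrix.mul_assoc, e, ih]

end IsWDrazin

/-- The W-weighted Drazin inverse solution of the restricted
matrix equation `W₁AW₁ X W₂BW₂ = D`. -/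
theorem wdrazin_solution_two_sided {m n p q : ℕ} (k₁ k₂ : ℕ)
    (A : Matrix (Fin m) (Fin n) ℍ) (W₁ : Matrix (Fin n) (Fin m) ℍ)
    (B : Matrix (Fin p) (Fin q) ℍ) (W₂ : Matrix (Fin q) (Fin p) ℍ)
    (hk₁ : k₁ = max (qindex (A * W₁)) (qindex (W₁ * A)))
    (hk₂ : k₂ = max (qindex (B * W₂)) (qindex (W₂ * B)))
    (D : Matrix (Fin n) (Fin p) ℍ)
    (hDc : ∀ j : Fin p, ∃ y : Fin n → ℍ,
      (fun i => D i j) = ((W₁ * A) ^ k₁).mulVec y)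
    (hDr : ∀ i : Fin n, ∃ y : Fin p → ℍ,
      (fun j => D i j) = Matrix.vecMul y ((B * W₂) ^ k₂))
    (G₁ : Matrix (Fin m) (Fin n) ℍ) (hG₁ : IsWDrazin A W₁ G₁)
    (G₂ : Matrix (Fin p) (Fin q) ℍ) (hG₂ : IsWDrazin B W₂ G₂) :
    W₁ * A * W₁ * (G₁ * D * G₂) * W₂ * B * W₂ = D ∧
    (∀ j : Fin q, ∃ y : Fin m → ℍ,
      (fun i => (G₁ * D * G₂) i j) = ((A * W₁) ^ k₁).mulVec y) ∧
    (∀ i : Fin m, ∃ y : Fin q → ℍ,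
      (fun j => (G₁ * D * G₂) i j) = Matrix.vecMul y ((W₂ * B) ^ k₂)) ∧
    (∀ X : Matrix (Fin m) (Fin q) ℍ, W₁ * A * W₁ * X * W₂ * B * W₂ = D →
      (∀ j : Fin q, ∃ y : Fin m → ℍ, (fun i => X i j) = ((A * W₁) ^ k₁).mulVec y) →
      (∀ i : Fin m, ∃ y : Fin q → ℍ,
        (fun j => X i j) = Matrix.vecMul y ((W₂ * B) ^ k₂)) →
      X = G₁ * D * G₂) := by
  subst hk₁ hk₂
  have hA := hG₁.pow_mul_left
  have hA' := hG₁.pow_mul_right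
  have hB := hG₂.pow_mul_left
  have hB' := hG₂.pow_mul_right
  refine ⟨?_, fun j => ?_, fun i => ?_, fun X hX hXc hXr => ?_⟩
  · obtain ⟨Y, hY⟩ := exists_eq_mul_right_of_columns hDc
    obtain ⟨Z, hZ⟩ := exists_eq_mul_left_of_rows hDr
    have hl : (W₁ * A) * (W₁ * G₁) * D = D := by
      rw [hY, ← Matrix.mul_assoc,
        ← (((Commute.refl _).mul_right hG₁.commute_right).pow_left _).eq, hA']
    have hr : D * ((G₂ * W₂) * (B * W₂)) = D := by
      rw [← hG₂.commute_left.eq, hZ, Matrix.mul_assoc, hB]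
    calc W₁ * A * W₁ * (G₁ * D * G₂) * W₂ * B * W₂
        = ((W₁ * A) * (W₁ * G₁) * D) * ((G₂ * W₂) * (B * W₂)) := by
          simp only [Matrix.mul_assoc]
      _ = D := by rw [hl, hr]
  · refine ⟨fun l => ((G₁ * W₁) ^ max (qindex (A * W₁)) (qindex (W₁ * A)) * G₁ * D * G₂) l j, ?_⟩
    conv_lhs => rw [← hG₁.mul_pow_left (max (qindex (A * W₁)) (qindex (W₁ * A)))]
    simp only [Matrix.mul_assoc]
    rfl
  · refine ⟨(G₁ * D * (G₂ * (W₂ * G₂) ^ max (qindex (B * W₂)) (qindex (W₂ * B)))) i, ?_⟩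
    conv_lhs => rw [← hG₂.mul_pow_right (max (qindex (B * W₂)) (qindex (W₂ * B)))]
    rw [← Matrix.mul_assoc (G₁ * D)]
    rfl
  · obtain ⟨Y, hY⟩ := exists_eq_mul_right_of_columns hXc
    obtain ⟨Z, hZ⟩ := exists_eq_mul_left_of_rows hXr
    have hl : (G₁ * W₁) * (A * W₁) * X = X := by
      rw [← hG₁.commute_left.eq, hY, ← Matrix.mul_assoc,
        ← (((Commute.refl _).mul_right hG₁.commute_left).pow_left _).eq, hA]
    have hr : X * ((W₂ * B) * (W₂ * G₂)) = X := by
      rw [hZ, Matrix.mul_assoc, hB']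
    calc X = ((G₁ * W₁) * (A * W₁) * X) * ((W₂ * B) * (W₂ * G₂)) := by rw [hl, hr]
      _ = G₁ * D * G₂ := by rw [← hX]; simp only [Matrix.mul_assoc]
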